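/- Asymptotically almost surely the following holds in D(n, m_Z): there exist a set T ⊆ W of colours with |T| = n − 1, a vertex u ∈ V, and a bijection f : V ∖ {u} → T such that for every vertex v ∈ V ∖ {u}, some edge of D(n, m_Z) with head v has colour f(v). -/

import Mathlib

open Filter

/-- The directed edges of the complete digraph on `Fin n`:
ordered pairs `(tail, head)` of distinct vertices. -/
abbrev DEdge (n : ℕ) := {e : Fin n × Fin n // e.1 ≠ e.2}

/-- `ε(n) = log log n / log n`. -/
noncomputable def eps (n : ℕ) : ℝ := Real.log (Real.log n) / Real.log n

/-- The number of available colours: `⌊(1 + 50 ε) n⌋`. -/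
noncomputable def numColours (n : ℕ) : ℕ := ⌊(1 + 50 * eps n) * n⌋₊

/-- The set of colours `W`. -/
abbrev Colour (n : ℕ) := Fin (numColours n)

/-- The sample space of the coloured random digraph process: a uniformly random
permutation of the edges (determining the random ordering `e₁, …, e_N`) together
with a uniformly random colouring of the edges. -/
abbrev SampleSpace (n : ℕ) := Equiv.Perm (DEdge n) × (DEdge n → Colour n)

/-- The (0-indexed) position of edge `e` in the random ordering determined by `ω`. -/
noncomputable def edgePos {n : ℕ} (ω : SampleSpace n) (e : DEdge n) : ℕ :=
  ((Fintype.equivFin (DEdge n)) (ω.1 e)).val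

/-- `e` is one of the first `m` edges of the process, i.e. an edge of `D(n,m)`. -/
def inProcess {n : ℕ} (ω : SampleSpace n) (m : ℕ) (e : DEdge n) : Prop :=
  edgePos ω e < m

/-- The probability of an event under the uniform measure on a finite sample space. -/
noncomputable def prob {Ω : Type*} [Fintype Ω] (p : Ω → Prop) : ℝ :=
  (Nat.card {ω : Ω // p ω} : ℝ) / (Fintype.card Ω : ℝ)

/-- Vertex `v` has in-degree zero in `D(n,m)`. -/
def InDegreeZero {n : ℕ} (ω : SampleSpace n) (m : ℕ) (v : Fin n) : Prop :=
  ∀ e : DEdge n, inProcess ω m e → e.val.2 ≠ v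

/-- The event `Z_m`: at most one vertex of `D(n,m)` has in-degree zero. -/
def ZEvent {n : ℕ} (ω : SampleSpace n) (m : ℕ) : Prop :=
  Set.Subsingleton {v : Fin n | InDegreeZero ω m v}

/-- `A` is the edge set of a spanning arborescence rooted at `u`: the root has no
in-edge, every other vertex has exactly one in-edge, and every vertex is reachable
from the root along edges of `A` (equivalently, for every vertex `v` there is
exactly one directed path from `u` to `v`). -/
def IsSpanningArborescence {n : ℕ} (A : Set (DEdge n)) (u : Fin n) : Prop :=
  (∀ e ∈ A, (e : DEdge n).val.2 ≠ u) ∧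
  (∀ v : Fin n, v ≠ u → ∃! e : DEdge n, e ∈ A ∧ e.val.2 = v) ∧
  (∀ v : Fin n, Relation.ReflTransGen (fun x y => ∃ e ∈ A, (e : DEdge n).val = (x, y)) u v)

/-- The event `A_m`: `D(n,m)` contains a spanning arborescence. -/
def AEvent {n : ℕ} (ω : SampleSpace n) (m : ℕ) : Prop :=
  ∃ (u : Fin n) (A : Set (DEdge n)), (∀ e ∈ A, inProcess ω m e) ∧ IsSpanningArborescence A u

/-- The event `R_m`: `D(n,m)` contains a rainbow spanning arborescence. -/
def REvent {n : ℕ} (ω : SampleSpace n) (m : ℕ) : Prop :=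
  ∃ (u : Fin n) (A : Set (DEdge n)), (∀ e ∈ A, inProcess ω m e) ∧
    IsSpanningArborescence A u ∧ Set.InjOn ω.2 A

/-- The hitting time `min {m : P m}`, with the convention `min ∅ = N = n(n-1)`. -/
noncomputable def hitTime (n : ℕ) (P : ℕ → Prop) : ℕ :=
  sInf ({m | P m} ∪ {n * (n - 1)})

section RandomDigraph

open Finset

section FiniteProbability

variable {Ω : Type*} [Fintype Ω]

/-- The expectation of `X` under the uniform measure on a finite sample space. -/
noncomputable def mean (X : Ω → ℝ) : ℝ := (∑ ω, X ω) / (Fintype.card Ω : ℝ)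

open Classical in
theorem prob_eq_mean (p : Ω → Prop) : prob p = mean (fun ω => if p ω then (1 : ℝ) else 0) := by
  unfold prob mean
  rw [Nat.card_eq_fintype_card, Fintype.card_subtype, Finset.sum_boole]

theorem mean_mono {X Y : Ω → ℝ} (h : ∀ ω, X ω ≤ Y ω) : mean X ≤ mean Y := by
  unfold mean
  gcongr
  exact h _

theorem mean_add (X Y : Ω → ℝ) : mean (fun ω => X ω + Y ω) = mean X + mean Y := by
  simp only [mean, Finset.sum_add_distrib, add_div]

theorem mean_sum {ι : Type*} (s : Finset ι) (X : ι → Ω → ℝ) :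
    mean (fun ω => ∑ i ∈ s, X i ω) = ∑ i ∈ s, mean (X i) := by
  simp only [mean]
  rw [Finset.sum_comm, Finset.sum_div]

theorem mean_const_mul (a : ℝ) (X : Ω → ℝ) : mean (fun ω => a * X ω) = a * mean X := by
  simp only [mean, ← Finset.mul_sum, mul_div_assoc]

theorem mean_const [Nonempty Ω] (a : ℝ) : mean (fun _ : Ω => a) = a := by
  have : (Fintype.card Ω : ℝ) ≠ 0 := by exact_mod_cast Fintype.card_ne_zero
  simp [mean, this]

theorem prob_nonneg (p : Ω → Prop) : 0 ≤ prob p :=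
  div_nonneg (Nat.cast_nonneg _) (Nat.cast_nonneg _)

theorem prob_mono {p q : Ω → Prop} (h : ∀ ω, p ω → q ω) : prob p ≤ prob q := by
  classical
  rw [prob_eq_mean, prob_eq_mean]
  refine mean_mono fun ω => ?_
  by_cases hp : p ω
  · simp [hp, h ω hp]
  · simp only [hp, if_false]
    split_ifs <;> norm_num

theorem prob_or_le (p q : Ω → Prop) : prob (fun ω => p ω ∨ q ω) ≤ prob p + prob q := by
  classical
  rw [prob_eq_mean, prob_eq_mean, prob_eq_mean, ← mean_add]
  refine mean_mono fun ω => ?_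
  by_cases hp : p ω <;> by_cases hq : q ω <;> simp [hp, hq]

theorem prob_exists_le {ι : Type*} (s : Finset ι) (p : ι → Ω → Prop) :
    prob (fun ω => ∃ i ∈ s, p i ω) ≤ ∑ i ∈ s, prob (p i) := by
  classical
  simp only [prob_eq_mean]
  rw [← mean_sum]
  refine mean_mono fun ω => ?_
  split_ifs with h
  · obtain ⟨i, hi, hp⟩ := h
    calc (1 : ℝ) = if p i ω then 1 else 0 := by simp [hp]
      _ ≤ _ := Finset.single_le_sum (f := fun i => if p i ω then (1 : ℝ) else 0)
        (fun j _ => by positivity) hi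
  · exact Finset.sum_nonneg fun j _ => by positivity

theorem prob_add_prob_not [Nonempty Ω] (p : Ω → Prop) : prob p + prob (fun ω => ¬ p ω) = 1 := by
  classical
  rw [prob_eq_mean, prob_eq_mean, ← mean_add]
  refine Eq.trans (congrArg mean (funext fun ω => ?_)) (mean_const 1)
  by_cases hp : p ω <;> simp [hp]

/-- Markov's inequality. -/
theorem prob_le_mean_div {X : Ω → ℝ} (h : ∀ ω, 0 ≤ X ω) {a : ℝ} (ha : 0 < a) :
    prob (fun ω => a ≤ X ω) ≤ mean X / a := by
  classical
  rw [prob_eq_mean, div_eq_inv_mul, ← mean_const_mul]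
  refine mean_mono fun ω => ?_
  split_ifs with hX
  · rw [← div_eq_inv_mul]
    exact (one_le_div ha).2 hX
  · exact mul_nonneg (inv_nonneg.2 ha.le) (h ω)

theorem mean_prod {Ω' : Type*} [Fintype Ω'] (X : Ω × Ω' → ℝ) :
    mean X = mean (fun ω => mean (fun ω' => X (ω, ω'))) := by
  simp only [mean, Fintype.sum_prod_type, Fintype.card_prod, Nat.cast_mul]
  rw [← Finset.sum_div, div_div, mul_comm]

theorem prob_prod_le {Ω' : Type*} [Fintype Ω'] [Nonempty Ω] (p : Ω → Ω' → Prop) {a : ℝ}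
    (h : ∀ ω, prob (p ω) ≤ a) : prob (fun x : Ω × Ω' => p x.1 x.2) ≤ a := by
  classical
  rw [prob_eq_mean, mean_prod, ← mean_const (Ω := Ω) a]
  refine mean_mono fun ω => ?_
  rw [← prob_eq_mean]
  exact h ω

theorem prob_prod_fst {Ω' : Type*} [Fintype Ω'] [Nonempty Ω'] (p : Ω → Prop) :
    prob (fun x : Ω × Ω' => p x.1) = prob p := by
  classical
  rw [prob_eq_mean, mean_prod, prob_eq_mean]
  exact congrArg mean (funext fun ω => mean_const (if p ω then (1 : ℝ) else 0))

end FiniteProbability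

section RandomPermutation

variable {α : Type*} [Fintype α] [DecidableEq α]

theorem card_perm_insert_mul (S F : Finset α) {e : α} (he : e ∉ F) :
    ((Fintype.card α : ℝ) - #F) *
        #{σ : Equiv.Perm α | ∀ x ∈ insert e F, σ x ∈ S} =
      ((#S : ℝ) - #F) * #{σ : Equiv.Perm α | ∀ x ∈ F, σ x ∈ S} := by
  have hsymm : ∀ e' ∈ Fᶜ, #{σ : Equiv.Perm α | ∀ x ∈ insert e' F, σ x ∈ S} =
      #{σ : Equiv.Perm α | ∀ x ∈ insert e F, σ x ∈ S} := by
    intro e' he'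
    rw [Finset.mem_compl] at he'
    refine Finset.card_nbij' (fun σ => σ * Equiv.swap e e') (fun σ => σ * Equiv.swap e e') ?_ ?_
      ?_ ?_
    · intro σ hσ
      simp only [Finset.coe_filter, Finset.mem_univ, true_and, Set.mem_ofPred_eq,
        Finset.forall_mem_insert, Equiv.Perm.mul_apply, Equiv.swap_apply_left] at hσ ⊢
      refine ⟨hσ.1, fun x hx => ?_⟩
      rw [Equiv.swap_apply_of_ne_of_ne (by rintro rfl; exact he hx) (by rintro rfl; exact he' hx)]
      exact hσ.2 x hx
    · intro σ hσ
      simp only [Finset.coe_filter, Finset.mem_univ, true_and, Set.mem_ofPred_eq,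
        Finset.forall_mem_insert, Equiv.Perm.mul_apply, Equiv.swap_apply_right] at hσ ⊢
      refine ⟨hσ.1, fun x hx => ?_⟩
      rw [Equiv.swap_apply_of_ne_of_ne (by rintro rfl; exact he hx) (by rintro rfl; exact he' hx)]
      exact hσ.2 x hx
    · intro σ _
      simp [mul_assoc]
    · intro σ _
      simp [mul_assoc]
  have hcount : ∀ σ ∈ ({σ : Equiv.Perm α | ∀ x ∈ F, σ x ∈ S} : Finset (Equiv.Perm α)),
      ((#{e' ∈ Fᶜ | σ e' ∈ S} : ℕ) : ℝ) = (#S : ℝ) - #F := by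
    intro σ hσ
    simp only [Finset.mem_filter, Finset.mem_univ, true_and] at hσ
    have himg : F.map σ.toEmbedding ⊆ S := by
      intro y hy
      obtain ⟨x, hx, rfl⟩ := Finset.mem_map.1 hy
      exact hσ x hx
    have hmap : ({e' ∈ Fᶜ | σ e' ∈ S} : Finset α).map σ.toEmbedding =
        S \ F.map σ.toEmbedding := by
      ext y
      obtain ⟨x, rfl⟩ := σ.surjective y
      simp [and_comm]
    rw [← Finset.card_map σ.toEmbedding, hmap, Finset.cast_card_sdiff himg, Finset.card_map]
  have hdouble : ∑ e' ∈ Fᶜ, (#{σ : Equiv.Perm α | ∀ x ∈ insert e' F, σ x ∈ S} : ℝ) =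
      ∑ σ ∈ ({σ : Equiv.Perm α | ∀ x ∈ F, σ x ∈ S} : Finset (Equiv.Perm α)),
        ((#{e' ∈ Fᶜ | σ e' ∈ S} : ℕ) : ℝ) := by
    have := Finset.sum_card_bipartiteAbove_eq_sum_card_bipartiteBelow (s := Fᶜ)
      (t := ({σ : Equiv.Perm α | ∀ x ∈ F, σ x ∈ S} : Finset (Equiv.Perm α)))
      (fun e' σ => σ e' ∈ S)
    rw [← Nat.cast_sum, ← Nat.cast_sum, Nat.cast_inj]
    convert this using 3 with e' _
    · ext σ
      simp [Finset.bipartiteAbove, and_comm]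
    · rfl
  rw [Finset.sum_congr rfl fun e' he' => by rw [hsymm e' he'], Finset.sum_congr rfl hcount,
    Finset.sum_const, Finset.sum_const, nsmul_eq_mul, nsmul_eq_mul, Finset.card_compl,
    Nat.cast_sub (Finset.card_le_univ F)] at hdouble
  rw [hdouble, mul_comm]

/-- The probability that a random permutation maps `F` into `S`. -/
theorem prob_perm_maps (S F : Finset α) :
    prob (fun σ : Equiv.Perm α => ∀ x ∈ F, σ x ∈ S) =
      ∏ i ∈ range #F, (((#S : ℝ) - i) / ((Fintype.card α : ℝ) - i)) := by
  have hprob : ∀ F : Finset α, prob (fun σ : Equiv.Perm α => ∀ x ∈ F, σ x ∈ S) =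
      #{σ : Equiv.Perm α | ∀ x ∈ F, σ x ∈ S} / (Fintype.card (Equiv.Perm α) : ℝ) := by
    intro F
    rw [prob, Nat.card_eq_fintype_card, Fintype.card_subtype]
  have hpos : (Fintype.card (Equiv.Perm α) : ℝ) ≠ 0 := by exact_mod_cast Fintype.card_ne_zero
  induction F using Finset.induction_on with
  | empty =>
    rw [hprob]
    simp [hpos]
  | insert e F he ih =>
    have hlt : #F < Fintype.card α := by
      have := Finset.card_le_univ (insert e F)
      rw [Finset.card_insert_of_notMem he] at this
      omega
    have hne : (Fintype.card α : ℝ) - #F ≠ 0 := by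
      have : (#F : ℝ) < Fintype.card α := by exact_mod_cast hlt
      linarith
    rw [Finset.card_insert_of_notMem he, Finset.prod_range_succ, ← ih, hprob, hprob]
    have := card_perm_insert_mul S F he
    field_simp
    linarith

theorem prob_perm_maps_le (S F : Finset α) :
    prob (fun σ : Equiv.Perm α => ∀ x ∈ F, σ x ∈ S) ≤ ((#S : ℝ) / Fintype.card α) ^ #F := by
  have hS : (#S : ℝ) ≤ Fintype.card α := by exact_mod_cast Finset.card_le_univ S
  by_cases hlt : #S < #F
  · rw [prob_perm_maps, Finset.prod_eq_zero (Finset.mem_range.2 hlt) (by simp)]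
    positivity
  have hconst : ((#S : ℝ) / Fintype.card α) ^ #F =
      ∏ _i ∈ range #F, ((#S : ℝ) / Fintype.card α) := by
    rw [Finset.prod_const, Finset.card_range]
  rw [prob_perm_maps, hconst]
  refine Finset.prod_le_prod (fun i hi => ?_) (fun i hi => ?_)
  all_goals
    have hi' : (i : ℝ) < #S := by
      rw [Finset.mem_range] at hi
      exact_mod_cast (show i < #S by omega)
  · exact div_nonneg (by linarith) (by linarith)
  · rw [div_le_div_iff₀ (by linarith) (by linarith [(Nat.cast_nonneg i : (0 : ℝ) ≤ i)])]
    nlinarith [(Nat.cast_nonneg i : (0 : ℝ) ≤ i)]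

/-- The exponential moment of the number of points of `I` which a random permutation maps
outside `S` is at most that of a binomial variable. -/
theorem mean_perm_pow_le (S I : Finset α) {θ : ℝ} (h0 : 0 ≤ θ) (h1 : θ ≤ 1) :
    mean (fun σ : Equiv.Perm α => θ ^ #{x ∈ I | σ x ∉ S}) ≤
      ((1 - θ) * ((#S : ℝ) / Fintype.card α) + θ) ^ #I := by
  have hexp : ∀ σ : Equiv.Perm α, θ ^ #{x ∈ I | σ x ∉ S} =
      ∑ M ∈ I.powerset, ((1 - θ) ^ #M * θ ^ #(I \ M)) * (if ∀ x ∈ M, σ x ∈ S then (1 : ℝ) else 0) := by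
    intro σ
    have : θ ^ #{x ∈ I | σ x ∉ S} = ∏ x ∈ I, ((1 - θ) * (if σ x ∈ S then (1 : ℝ) else 0) + θ) := by
      rw [← Finset.prod_const, Finset.prod_filter]
      refine Finset.prod_congr rfl fun x _ => ?_
      by_cases h : σ x ∈ S <;> simp [h]
    rw [this, Finset.prod_add]
    refine Finset.sum_congr rfl fun M _ => ?_
    rw [Finset.prod_mul_distrib, Finset.prod_const, Finset.prod_const, Finset.prod_boole, mul_right_comm]
    congr 1
    split_ifs <;> rfl
  simp only [hexp]
  rw [mean_sum]
  calc _ ≤ ∑ M ∈ I.powerset, ((1 - θ) ^ #M * θ ^ #(I \ M)) * ((#S : ℝ) / Fintype.card α) ^ #M := by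
        refine Finset.sum_le_sum fun M _ => ?_
        rw [mean_const_mul]
        refine mul_le_mul_of_nonneg_left ?_ (mul_nonneg (pow_nonneg (by linarith) _) (by positivity))
        refine le_trans (le_of_eq ?_) (prob_perm_maps_le S M)
        rw [prob_eq_mean]
        refine congrArg mean (funext fun σ => ?_)
        split_ifs <;> rfl
    _ = _ := by
        rw [← Finset.prod_const, Finset.prod_add]
        refine Finset.sum_congr rfl fun M _ => ?_
        rw [Finset.prod_const, Finset.prod_const, mul_pow, mul_right_comm]

end RandomPermutation

section RandomColouring

variable {V E W : Type*} [Fintype V] [Fintype E] [Fintype W] [DecidableEq V] [DecidableEq E]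
  [DecidableEq W]

/-- In a uniformly random colouring, the colours of the edges in `G` all lie in a set of at most
`a` colours determined by the edges outside `G` with probability at most `(a / K) ^ #G`. -/
theorem prob_colours_mem_le [Nonempty W] (G : Finset E) (A : (E → W) → Finset W) {a : ℕ}
    (hA : ∀ c c' : E → W, (∀ x, x ∉ G → c x = c' x) → A c = A c') (ha : ∀ c, #(A c) ≤ a) :
    prob (fun c : E → W => ∀ x ∈ G, c x ∈ A c) ≤ ((a : ℝ) / Fintype.card W) ^ #G := by
  classical
  have hK : (Fintype.card W : ℝ) ≠ 0 := by exact_mod_cast Fintype.card_ne_zero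
  set s : Finset (E → W) := {c | ∀ x ∈ G, c x ∈ A c} with hs
  let r : (E → W) → ({x // x ∉ G} → W) := fun c x => c x
  have hfib : ∀ b ∈ s.image r, #{c ∈ s | r c = b} ≤ a ^ #G := by
    intro b hb
    obtain ⟨c₀, _, rfl⟩ := Finset.mem_image.1 hb
    have hcard : #(Fintype.piFinset fun _ : G => A c₀) ≤ a ^ #G := by
      rw [Fintype.card_piFinset]
      simpa using Nat.pow_le_pow_left (ha c₀) _
    refine le_trans (Finset.card_le_card_of_injOn (fun c (x : G) => c x) ?_ ?_) hcard
    · intro c hc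
      simp only [Finset.coe_filter, Set.mem_ofPred_eq, hs, Finset.mem_filter, Finset.mem_univ,
        true_and] at hc
      rw [Finset.mem_coe, Fintype.mem_piFinset]
      intro x
      rw [← hA c c₀ fun x hx => congrFun hc.2 ⟨x, hx⟩]
      exact hc.1 x x.2
    · intro c hc c' hc' h
      simp only [Finset.coe_filter, Set.mem_ofPred_eq] at hc hc'
      funext x
      by_cases hx : x ∈ G
      · exact congrFun h ⟨x, hx⟩
      · exact congrFun (hc.2.trans hc'.2.symm) ⟨x, hx⟩
  have hle : #G ≤ Fintype.card E := Finset.card_le_univ G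
  have hcard : #s ≤ a ^ #G * Fintype.card W ^ (Fintype.card E - #G) := by
    refine (Finset.card_le_mul_card_image s _ hfib).trans (Nat.mul_le_mul_left _ ?_)
    refine (Finset.card_le_univ _).trans (le_of_eq ?_)
    rw [Fintype.card_fun, Fintype.card_subtype_compl, Fintype.card_coe]
  have hcard' : (#s : ℝ) ≤ (a : ℝ) ^ #G * (Fintype.card W : ℝ) ^ (Fintype.card E - #G) := by
    exact_mod_cast hcard
  rw [prob, Nat.card_eq_fintype_card, Fintype.card_subtype, Fintype.card_fun, Nat.cast_pow,
    div_pow, div_le_div_iff₀ (by positivity) (by positivity)]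
  calc (#s : ℝ) * (Fintype.card W : ℝ) ^ #G
      ≤ (a : ℝ) ^ #G * (Fintype.card W : ℝ) ^ (Fintype.card E - #G) *
        (Fintype.card W : ℝ) ^ #G := by gcongr
    _ = _ := by rw [mul_assoc, ← pow_add, Nat.sub_add_cancel hle]

theorem prob_colour_eq_le [Nonempty W] {x y : E} (hxy : x ≠ y) :
    prob (fun c : E → W => c x = c y) ≤ 1 / Fintype.card W := by
  have := prob_colours_mem_le (W := W) {x} (fun c => {c y}) (a := 1)
    (fun c c' h => by rw [h y (by simpa using hxy.symm)]) (fun c => by simp)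
  simpa using this

omit [Fintype E] in
/-- Hall's condition outside the colours already used on `L` yields an injective choice of
colours. -/
theorem exists_injOn_colouring {L H : Finset V} {e : V → E} {D : V → Finset E}
    (hVW : Fintype.card V ≤ Fintype.card W) {c : E → W}
    (hL : Set.InjOn (fun v => c (e v)) L)
    (hH : ∀ B ⊆ H, B.Nonempty → ∀ T : Finset W, #T = #B →
      ∃ x ∈ B.biUnion D, c x ∉ T ∪ L.image fun v => c (e v)) :
    ∃ f : V → W, Set.InjOn f (L ∪ H : Finset V) ∧
      ∀ v ∈ L ∪ H, (v ∈ L ∧ f v = c (e v)) ∨ (v ∈ H ∧ ∃ x ∈ D v, c x = f v) := by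
  classical
  set C := L.image fun v => c (e v) with hC
  obtain ⟨g, hginj, hg⟩ := (Finset.all_card_le_biUnion_card_iff_exists_injective
    (fun v : H => (D v).image c \ C)).1 (by
      intro A
      rcases A.eq_empty_or_nonempty with rfl | hA
      · simp
      by_contra! hlt
      set B : Finset V := A.map (Function.Embedding.subtype _) with hB
      have hBA : #B = #A := Finset.card_map _
      obtain ⟨T, hT, hTcard⟩ := Finset.exists_superset_card_eq (α := W) hlt.le
        ((hBA ▸ Finset.card_le_univ B).trans hVW)
      obtain ⟨x, hx, hxT⟩ := hH B (by
        intro v hv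
        obtain ⟨w, _, rfl⟩ := Finset.mem_map.1 hv
        exact w.2) (hA.map) T (hTcard.trans hBA.symm)
      rw [Finset.mem_union, not_or] at hxT
      obtain ⟨v, hv, hxv⟩ := Finset.mem_biUnion.1 hx
      obtain ⟨w, hw, rfl⟩ := Finset.mem_map.1 hv
      refine hxT.1 (hT (Finset.mem_biUnion.2 ⟨w, hw, Finset.mem_sdiff.2 ⟨?_, hxT.2⟩⟩))
      exact Finset.mem_image_of_mem c hxv)
  refine ⟨fun v => if h : v ∈ H then g ⟨v, h⟩ else c (e v), ?_, ?_⟩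
  · have hne : ∀ v w (hv : v ∈ H), w ∈ L → g ⟨v, hv⟩ ≠ c (e w) := by
      intro v w hv hw heq
      exact (Finset.mem_sdiff.1 (hg ⟨v, hv⟩)).2 (heq ▸ Finset.mem_image_of_mem _ hw)
    intro v hv w hw hvw
    simp only [Finset.coe_union, Set.mem_union, Finset.mem_coe] at hv hw
    by_cases hvH : v ∈ H <;> by_cases hwH : w ∈ H <;>
      simp only [hvH, hwH, dif_pos, dif_neg, not_false_eq_true, or_true, or_false] at hvw hv hw
    · exact congrArg Subtype.val (hginj hvw)
    · exact absurd hvw (hne v w hvH hw)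
    · exact absurd hvw.symm (hne w v hwH hv)
    · exact hL hv hw hvw
  · intro v hv
    by_cases hvH : v ∈ H
    · refine Or.inr ⟨hvH, ?_⟩
      have := (Finset.mem_sdiff.1 (hg ⟨v, hvH⟩)).1
      simpa [hvH] using this
    · rw [Finset.mem_union] at hv
      exact Or.inl ⟨hv.resolve_right hvH, by simp [hvH]⟩

/-- The bound on the failure probability of Hall's condition. -/
noncomputable def hallBound (n K l d : ℕ) : ℝ :=
  (l : ℝ) ^ 2 / K +
    ∑ b ∈ Icc 1 n, (n.choose b : ℝ) * (K.choose b) * (((b + l : ℕ) : ℝ) / K) ^ (d * b)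

theorem prob_not_exists_injOn_colouring_le [Nonempty W] {l d : ℕ} {L H : Finset V} (head : E → V)
    {e : V → E} {D : V → Finset E} (hVW : Fintype.card V ≤ Fintype.card W) (hLH : Disjoint L H)
    (hl : #L ≤ l) (he : ∀ v ∈ L, head (e v) = v) (hD : ∀ v ∈ H, #(D v) = d)
    (hDhead : ∀ v ∈ H, ∀ x ∈ D v, head x = v) :
    prob (fun c : E → W => ¬ ∃ f : V → W, Set.InjOn f (L ∪ H : Finset V) ∧
      ∀ v ∈ L ∪ H, (v ∈ L ∧ f v = c (e v)) ∨ (v ∈ H ∧ ∃ x ∈ D v, c x = f v)) ≤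
    hallBound (Fintype.card V) (Fintype.card W) l d := by
  classical
  have hK : (0 : ℝ) < Fintype.card W := by exact_mod_cast Fintype.card_pos
  set badL : (E → W) → Prop := fun c => ∃ p ∈ L.offDiag, c (e p.1) = c (e p.2)
  set badH : (E → W) → Prop := fun c => ∃ b ∈ Icc 1 (Fintype.card V),
    ∃ q ∈ H.powersetCard b ×ˢ (univ : Finset W).powersetCard b,
      ∀ x ∈ q.1.biUnion D, c x ∈ q.2 ∪ L.image fun v => c (e v)
  have hbad : ∀ c : E → W, (¬ ∃ f : V → W, Set.InjOn f (L ∪ H : Finset V) ∧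
      ∀ v ∈ L ∪ H, (v ∈ L ∧ f v = c (e v)) ∨ (v ∈ H ∧ ∃ x ∈ D v, c x = f v)) →
      badL c ∨ badH c := by
    intro c hc
    by_contra! hcon
    refine hc (exists_injOn_colouring hVW ?_ ?_)
    · intro v hv w hw hvw
      by_contra hne
      exact hcon.1 ⟨(v, w), Finset.mem_offDiag.2 ⟨hv, hw, hne⟩, hvw⟩
    · intro B hB hBne T hT
      by_contra! hall
      exact hcon.2 ⟨#B, Finset.mem_Icc.2 ⟨hBne.card_pos, Finset.card_le_univ B⟩, (B, T),
        Finset.mem_product.2 ⟨Finset.mem_powersetCard.2 ⟨hB, rfl⟩,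
          Finset.mem_powersetCard.2 ⟨Finset.subset_univ _, hT⟩⟩, hall⟩
  have hbadL : prob badL ≤ (l : ℝ) ^ 2 / Fintype.card W := by
    calc prob badL ≤ ∑ p ∈ L.offDiag, prob (fun c : E → W => c (e p.1) = c (e p.2)) :=
          prob_exists_le _ _
      _ ≤ ∑ p ∈ L.offDiag, (1 : ℝ) / Fintype.card W := by
          refine Finset.sum_le_sum fun p hp => prob_colour_eq_le fun h => ?_
          rw [Finset.mem_offDiag] at hp
          exact hp.2.2 (by rw [← he _ hp.1, ← he _ hp.2.1, h])
      _ = (#L.offDiag : ℝ) / Fintype.card W := by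
          rw [Finset.sum_const, nsmul_eq_mul, mul_one_div]
      _ ≤ _ := by
          gcongr
          have h1 : #L.offDiag ≤ #L * #L := by
            rw [Finset.offDiag_card]
            exact Nat.sub_le _ _
          have h2 : #L.offDiag ≤ l ^ 2 := by nlinarith
          exact_mod_cast h2
  have hterm : ∀ b, ∀ q ∈ H.powersetCard b ×ˢ (univ : Finset W).powersetCard b,
      prob (fun c : E → W => ∀ x ∈ q.1.biUnion D, c x ∈ q.2 ∪ L.image fun v => c (e v)) ≤
        (((b + l : ℕ) : ℝ) / Fintype.card W) ^ (d * b) := by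
    intro b q hq
    obtain ⟨hq1, hq2⟩ := Finset.mem_product.1 hq
    obtain ⟨hB, hBb⟩ := Finset.mem_powersetCard.1 hq1
    have hT := (Finset.mem_powersetCard.1 hq2).2
    have hcard : #(q.1.biUnion D) = d * b := by
      rw [Finset.card_biUnion, Finset.sum_congr rfl fun v hv => hD v (hB hv), Finset.sum_const,
        smul_eq_mul, hBb, mul_comm]
      intro v hv w hw hvw
      refine Finset.disjoint_left.2 fun x hxv hxw => ?_
      exact hvw ((hDhead v (hB hv) x hxv).symm.trans (hDhead w (hB hw) x hxw))
    rw [← hcard]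
    refine prob_colours_mem_le _ (fun c => q.2 ∪ L.image fun v => c (e v)) ?_ ?_
    · intro c c' hcc
      have : L.image (fun v => c (e v)) = L.image fun v => c' (e v) := by
        refine Finset.image_congr fun v hv => hcc _ fun hmem => ?_
        obtain ⟨w, hw, hx⟩ := Finset.mem_biUnion.1 hmem
        have hvw : v = w := (he v hv).symm.trans (hDhead w (hB hw) _ hx)
        exact Finset.disjoint_left.1 hLH hv (hvw ▸ hB hw)
      simp only [this]
    · intro c
      exact (Finset.card_union_le _ _).trans
        (add_le_add hT.le (Finset.card_image_le.trans hl))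
  have hbadH : prob badH ≤ ∑ b ∈ Icc 1 (Fintype.card V), ((Fintype.card V).choose b : ℝ) *
      ((Fintype.card W).choose b) * (((b + l : ℕ) : ℝ) / Fintype.card W) ^ (d * b) := by
    refine (prob_exists_le _ _).trans (Finset.sum_le_sum fun b _ => ?_)
    refine (prob_exists_le _ _).trans ((Finset.sum_le_sum (hterm b)).trans ?_)
    rw [Finset.sum_const, nsmul_eq_mul, Finset.card_product, Finset.card_powersetCard,
      Finset.card_powersetCard, Nat.cast_mul, Finset.card_univ]
    gcongr
    exact Finset.card_le_univ H
  exact (prob_mono hbad).trans ((prob_or_le _ _).trans (add_le_add hbadL hbadH))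

end RandomColouring

section InDegrees

/-- The edges with head `v`. -/
def inEdges {n : ℕ} (v : Fin n) : Finset (DEdge n) := {e | e.val.2 = v}

/-- The positions of the process from time `m` on, identified with edges. -/
noncomputable def latePositions (n m : ℕ) : Finset (DEdge n) :=
  {e | m ≤ (Fintype.equivFin (DEdge n) e).val}

theorem mem_inEdges {n : ℕ} {v : Fin n} {e : DEdge n} : e ∈ inEdges v ↔ e.val.2 = v := by
  simp [inEdges]

theorem inProcess_iff {n : ℕ} (ω : SampleSpace n) (m : ℕ) (e : DEdge n) :
    inProcess ω m e ↔ ω.1 e ∉ latePositions n m := by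
  simp [inProcess, edgePos, latePositions]

theorem inDegreeZero_iff {n : ℕ} (ω : SampleSpace n) (m : ℕ) (v : Fin n) :
    InDegreeZero ω m v ↔ ∀ e ∈ inEdges v, ω.1 e ∈ latePositions n m := by
  simp only [InDegreeZero, inProcess_iff, mem_inEdges]
  refine forall_congr' fun e => ?_
  tauto

theorem card_inEdges {n : ℕ} (v : Fin n) : #(inEdges v) = n - 1 := by
  have : #(inEdges v) = #(univ.erase v) := by
    refine Finset.card_bij (fun e _ => e.val.1) ?_ ?_ ?_
    · intro e he
      rw [mem_inEdges] at he
      exact Finset.mem_erase.2 ⟨he ▸ e.2, Finset.mem_univ _⟩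
    · intro e he e' he' h
      rw [mem_inEdges] at he he'
      exact Subtype.ext (Prod.ext h (he.trans he'.symm))
    · intro w hw
      exact ⟨⟨(w, v), (Finset.mem_erase.1 hw).1⟩, mem_inEdges.2 rfl, rfl⟩
  rw [this, Finset.card_erase_of_mem (Finset.mem_univ v), Finset.card_univ, Fintype.card_fin]

theorem card_dEdge (n : ℕ) : Fintype.card (DEdge n) = n * (n - 1) := by
  have h : (univ : Finset (DEdge n)) = univ.biUnion fun v : Fin n => inEdges v := by
    ext e
    simp [mem_inEdges]
  rw [← Finset.card_univ, h, Finset.card_biUnion]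
  · simp [card_inEdges]
  · intro v _ w _ hvw
    refine Finset.disjoint_left.2 fun e hv hw => ?_
    exact hvw ((mem_inEdges.1 hv).symm.trans (mem_inEdges.1 hw))

theorem card_latePositions {n m : ℕ} (hm : m ≤ n * (n - 1)) :
    (#(latePositions n m) : ℝ) = (n * (n - 1) : ℕ) - m := by
  have : #(latePositions n m) = #(({i | m ≤ i.val} : Finset (Fin (Fintype.card (DEdge n))))) := by
    rw [← Finset.card_map (Fintype.equivFin (DEdge n)).toEmbedding]
    congr 1
    ext i
    obtain ⟨e, rfl⟩ := (Fintype.equivFin (DEdge n)).surjective i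
    simp [latePositions]
  have hc : #(latePositions n m) = n * (n - 1) - m := by
    have hlt := Fin.card_filter_val_lt (n := Fintype.card (DEdge n)) (m := m)
    have hadd := Finset.card_filter_add_card_filter_not (s := univ)
      (fun i : Fin (Fintype.card (DEdge n)) => i.val < m)
    have hge : #({i | m ≤ i.val} : Finset (Fin (Fintype.card (DEdge n)))) =
        #({i | ¬ i.val < m} : Finset (Fin (Fintype.card (DEdge n)))) := by
      congr 1
      ext i
      simp
    rw [← hge, ← this, Finset.card_univ, Fintype.card_fin] at hadd
    have hcard := card_dEdge n
    omega
  rw [hc, Nat.cast_sub hm]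

/-- The probability that a given vertex has in-degree zero in `D(n,m)`. -/
noncomputable def isolatedProb (n m : ℕ) : ℝ :=
  ∏ i ∈ range (n - 1), ((((n * (n - 1) : ℕ) : ℝ) - m - i) / (((n * (n - 1) : ℕ) : ℝ) - i))

theorem prob_inEdges_late {n m : ℕ} (hm : m ≤ n * (n - 1)) (v : Fin n) :
    prob (fun σ : Equiv.Perm (DEdge n) => ∀ e ∈ inEdges v, σ e ∈ latePositions n m) =
      isolatedProb n m := by
  rw [prob_perm_maps, card_latePositions hm, card_inEdges, card_dEdge, isolatedProb]

theorem prob_inEdges_late_pair {n m : ℕ} (hm : m + 2 * (n - 1) ≤ n * (n - 1)) {v w : Fin n}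
    (hvw : v ≠ w) :
    prob (fun σ : Equiv.Perm (DEdge n) =>
      (∀ e ∈ inEdges v, σ e ∈ latePositions n m) ∧ ∀ e ∈ inEdges w, σ e ∈ latePositions n m) ≤
      isolatedProb n m ^ 2 := by
  have hdisj : Disjoint (inEdges v) (inEdges w) :=
    Finset.disjoint_left.2 fun e hv hw => hvw ((mem_inEdges.1 hv).symm.trans (mem_inEdges.1 hw))
  have hunion : (fun σ : Equiv.Perm (DEdge n) =>
      (∀ e ∈ inEdges v, σ e ∈ latePositions n m) ∧ ∀ e ∈ inEdges w, σ e ∈ latePositions n m) =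
      fun σ => ∀ e ∈ inEdges v ∪ inEdges w, σ e ∈ latePositions n m := by
    funext σ
    simp only [Finset.forall_mem_union]
  rw [hunion, prob_perm_maps, card_latePositions (by omega), Finset.card_union_of_disjoint hdisj,
    card_inEdges, card_inEdges, card_dEdge, Finset.prod_range_add, sq, isolatedProb]
  have hbig : ((m : ℝ) + 2 * ((n - 1 : ℕ) : ℝ)) ≤ ((n * (n - 1) : ℕ) : ℝ) := by exact_mod_cast hm
  have hfac : ∀ i ∈ range (n - 1), (i : ℝ) + 1 ≤ ((n - 1 : ℕ) : ℝ) := by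
    intro i hi
    exact_mod_cast Finset.mem_range.1 hi
  have hm0 : (0 : ℝ) ≤ m := Nat.cast_nonneg m
  refine mul_le_mul_of_nonneg_left (Finset.prod_le_prod (fun i hi => ?_) fun i hi => ?_)
    (Finset.prod_nonneg fun i hi => ?_)
  · have := hfac i hi
    rw [Nat.cast_add]
    exact div_nonneg (by linarith) (by linarith)
  · have := hfac i hi
    have hi0 : (0 : ℝ) ≤ i := Nat.cast_nonneg i
    rw [Nat.cast_add, div_le_div_iff₀ (by linarith) (by linarith)]
    nlinarith [mul_nonneg hm0 (Nat.cast_nonneg (n - 1) : (0 : ℝ) ≤ ((n - 1 : ℕ) : ℝ))]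
  · have := hfac i hi
    have hi0 : (0 : ℝ) ≤ i := Nat.cast_nonneg i
    exact div_nonneg (by linarith) (by linarith)

/-- By Chebyshev's inequality, it is unlikely that at most one vertex has in-degree zero as long as
the expected number of such vertices is large. -/
theorem prob_subsingleton_late_le {n m : ℕ} (hm : m + 2 * (n - 1) ≤ n * (n - 1))
    (hμ : 1 < n * isolatedProb n m) :
    prob (fun σ : Equiv.Perm (DEdge n) =>
      Set.Subsingleton {v : Fin n | ∀ e ∈ inEdges v, σ e ∈ latePositions n m}) ≤
      (n * isolatedProb n m) / (n * isolatedProb n m - 1) ^ 2 := by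
  classical
  set p := isolatedProb n m with hp
  set μ := (n : ℝ) * p with hμdef
  let Z : Equiv.Perm (DEdge n) → Fin n → ℝ :=
    fun σ v => if ∀ e ∈ inEdges v, σ e ∈ latePositions n m then 1 else 0
  let X : Equiv.Perm (DEdge n) → ℝ := fun σ => ∑ v, Z σ v
  have hZ : ∀ v, mean (fun σ => Z σ v) = p := by
    intro v
    rw [hp, ← prob_inEdges_late (by omega) v, prob_eq_mean]
    refine congrArg mean (funext fun σ => ?_)
    simp only [Z]
    split_ifs <;> rfl
  have hX : mean X = μ := by
    simp only [X]
    rw [mean_sum, Finset.sum_congr rfl fun v _ => hZ v]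
    simp [hμdef]
  have hZZ : ∀ v w, mean (fun σ => Z σ v * Z σ w) ≤ p ^ 2 + if v = w then p else 0 := by
    intro v w
    by_cases hvw : v = w
    · subst hvw
      have : (fun σ => Z σ v * Z σ v) = fun σ => Z σ v := by
        funext σ
        simp only [Z]
        split_ifs <;> norm_num
      rw [this, hZ, if_pos rfl]
      nlinarith [sq_nonneg p]
    · rw [if_neg hvw, add_zero]
      refine le_trans (le_of_eq ?_) (prob_inEdges_late_pair hm hvw)
      rw [prob_eq_mean]
      refine congrArg mean (funext fun σ => ?_)
      simp only [Z]
      by_cases h1 : ∀ e ∈ inEdges v, σ e ∈ latePositions n m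
      · by_cases h2 : ∀ e ∈ inEdges w, σ e ∈ latePositions n m
        · rw [if_pos h1, if_pos h2, if_pos ⟨h1, h2⟩, one_mul]
        · rw [if_neg h2, mul_zero, if_neg fun h => h2 (And.right h)]
      · rw [if_neg h1, zero_mul, if_neg fun h => h1 (And.left h)]
  have hXX : mean (fun σ => X σ ^ 2) ≤ μ ^ 2 + μ := by
    have : (fun σ => X σ ^ 2) = fun σ => ∑ v, ∑ w, Z σ v * Z σ w := by
      funext σ
      rw [sq, Finset.sum_mul_sum]
    rw [this, mean_sum]
    calc _ ≤ ∑ v : Fin n, ∑ w : Fin n, (p ^ 2 + if v = w then p else 0) := by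
          refine Finset.sum_le_sum fun v _ => ?_
          rw [mean_sum]
          exact Finset.sum_le_sum fun w _ => hZZ v w
      _ = μ ^ 2 + μ := by
          simp only [Finset.sum_add_distrib, Finset.sum_const, Finset.card_univ, Fintype.card_fin,
            nsmul_eq_mul, Finset.sum_ite_eq, Finset.mem_univ, if_true, hμdef]
          ring
  have hvar : mean (fun σ => (X σ - μ) ^ 2) ≤ μ := by
    have : (fun σ => (X σ - μ) ^ 2) = fun σ => X σ ^ 2 + ((-(2 * μ)) * X σ + μ ^ 2) := by
      funext σ
      ring
    rw [this, mean_add, mean_add, mean_const_mul, mean_const, hX]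
    nlinarith
  have hpos : 0 < (μ - 1) ^ 2 := by
    have : 0 < μ - 1 := by linarith
    positivity
  refine le_trans (prob_mono fun σ hσ => ?_)
    ((prob_le_mean_div (X := fun σ => (X σ - μ) ^ 2) (fun σ => sq_nonneg _) hpos).trans
      (div_le_div_of_nonneg_right hvar hpos.le))
  have hXle : X σ ≤ 1 := by
    simp only [X, Z, Finset.sum_boole]
    have : #{v : Fin n | ∀ e ∈ inEdges v, σ e ∈ latePositions n m} ≤ 1 := by
      rw [Finset.card_le_one]
      intro v hv w hw
      exact hσ (by simpa using hv) (by simpa using hw)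
    exact_mod_cast this
  show (μ - 1) ^ 2 ≤ (X σ - μ) ^ 2
  nlinarith

/-- The in-degree of `v` in `D(n,m)`. -/
noncomputable def inDeg {n : ℕ} (σ : Equiv.Perm (DEdge n)) (m : ℕ) (v : Fin n) : ℕ :=
  #{e ∈ inEdges v | σ e ∉ latePositions n m}

theorem prob_inDeg_lt_le {n m : ℕ} (hn : 2 ≤ n) (hm : m ≤ n * (n - 1)) (d : ℕ) (v : Fin n) :
    prob (fun σ : Equiv.Perm (DEdge n) => inDeg σ m v < d) ≤
      4 ^ d * Real.exp (-(3 / 4 * m / n)) := by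
  have hn1 : (1 : ℝ) < n := by exact_mod_cast hn
  have hcast : ((n - 1 : ℕ) : ℝ) = (n : ℝ) - 1 := by rw [Nat.cast_sub (by omega)]; simp
  have hmoment : mean (fun σ : Equiv.Perm (DEdge n) => (1 / 4 : ℝ) ^ inDeg σ m v) ≤
      Real.exp (-(3 / 4 * m / n)) := by
    refine (mean_perm_pow_le (latePositions n m) (inEdges v) (by norm_num) (by norm_num)).trans ?_
    rw [card_latePositions hm, card_inEdges, card_dEdge]
    have hm' : (m : ℝ) ≤ ((n * (n - 1) : ℕ) : ℝ) := by exact_mod_cast hm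
    have hN : ((n * (n - 1) : ℕ) : ℝ) = n * (n - 1) := by rw [Nat.cast_mul, hcast]
    rw [hN] at hm' ⊢
    have hNpos : (0 : ℝ) < n * (n - 1) := by nlinarith
    have hbase : (1 - 1 / 4 : ℝ) * (((n : ℝ) * (n - 1) - m) / (n * (n - 1))) + 1 / 4 ≤
        Real.exp (-(3 / 4 * m / (n * (n - 1)))) := by
      refine le_trans (le_of_eq ?_) (Real.add_one_le_exp _)
      have : (n : ℝ) - 1 ≠ 0 := by linarith
      field_simp
      ring
    refine (pow_le_pow_left₀ ?_ hbase _).trans (le_of_eq ?_)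
    · have : 0 ≤ ((n : ℝ) * (n - 1) - m) / (n * (n - 1)) := div_nonneg (by linarith) hNpos.le
      linarith
    · rw [← Real.exp_nat_mul, hcast]
      congr 1
      have : (n : ℝ) - 1 ≠ 0 := by linarith
      field_simp
  have hmarkov := prob_le_mean_div (X := fun σ : Equiv.Perm (DEdge n) => (1 / 4 : ℝ) ^ inDeg σ m v)
    (fun σ => by positivity) (a := (1 / 4 : ℝ) ^ d) (by positivity)
  refine (prob_mono fun σ hσ => ?_).trans (hmarkov.trans ?_)
  · exact pow_le_pow_of_le_one (by norm_num) (by norm_num) hσ.le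
  · rw [div_eq_inv_mul, ← inv_pow]
    norm_num only [one_div, inv_inv] at hmoment ⊢
    gcongr

theorem prob_card_inDeg_lt_le {n m : ℕ} (hn : 2 ≤ n) (hm : m ≤ n * (n - 1)) (d : ℕ) {l : ℕ} :
    prob (fun σ : Equiv.Perm (DEdge n) => l < #{v : Fin n | inDeg σ m v < d}) ≤
      n * (4 ^ d * Real.exp (-(3 / 4 * m / n))) / (l + 1) := by
  classical
  have hmarkov := prob_le_mean_div
    (X := fun σ : Equiv.Perm (DEdge n) => (#{v : Fin n | inDeg σ m v < d} : ℝ))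
    (fun σ => by positivity) (a := (l : ℝ) + 1) (by positivity)
  refine (prob_mono fun σ hσ => ?_).trans (hmarkov.trans ?_)
  · exact_mod_cast hσ
  · gcongr
    simp only [← Finset.sum_boole]
    rw [mean_sum]
    calc _ ≤ ∑ v : Fin n, 4 ^ d * Real.exp (-(3 / 4 * m / n)) := by
          refine Finset.sum_le_sum fun v _ => ?_
          refine le_trans (le_of_eq ?_) (prob_inDeg_lt_le hn hm d v)
          rw [prob_eq_mean]
          refine congrArg mean (funext fun σ => ?_)
          split_ifs <;> rfl
      _ = _ := by simp

end InDegrees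

section Combination

/-- The vertices of in-degree zero in `D(n,m)`. -/
def isolatedSet {n : ℕ} (σ : Equiv.Perm (DEdge n)) (m : ℕ) : Set (Fin n) :=
  {v | ∀ e ∈ inEdges v, σ e ∈ latePositions n m}

theorem mem_latePositions_of_le {n m m' : ℕ} (h : m ≤ m') {e : DEdge n}
    (he : e ∈ latePositions n m') : e ∈ latePositions n m := by
  simp only [latePositions, Finset.mem_filter, Finset.mem_univ, true_and] at he ⊢
  omega

theorem isolatedSet_anti {n m m' : ℕ} (σ : Equiv.Perm (DEdge n)) (h : m ≤ m') :
    isolatedSet σ m' ⊆ isolatedSet σ m :=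
  fun _ hv e he => mem_latePositions_of_le h (hv e he)

theorem isolatedSet_total {n : ℕ} (hn : 2 ≤ n) (σ : Equiv.Perm (DEdge n)) :
    isolatedSet σ (n * (n - 1)) = ∅ := by
  ext v
  simp only [Set.mem_empty_iff_false, iff_false]
  intro hv
  obtain ⟨e, he⟩ : (inEdges v).Nonempty := by
    rw [← Finset.card_pos, card_inEdges]
    omega
  have := hv e he
  simp only [latePositions, Finset.mem_filter, Finset.mem_univ, true_and] at this
  have hlt := (Fintype.equivFin (DEdge n) (σ e)).isLt
  have hcard := card_dEdge n
  omega

theorem zEvent_iff {n : ℕ} (ω : SampleSpace n) (m : ℕ) :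
    ZEvent ω m ↔ (isolatedSet ω.1 m).Subsingleton := by
  simp only [ZEvent, inDegreeZero_iff, isolatedSet]

/-- The time at which at most one vertex of in-degree zero remains. -/
noncomputable def zTime {n : ℕ} (σ : Equiv.Perm (DEdge n)) : ℕ :=
  hitTime n fun m => (isolatedSet σ m).Subsingleton

theorem hitTime_zEvent {n : ℕ} (ω : SampleSpace n) : hitTime n (ZEvent ω) = zTime ω.1 :=
  congrArg (hitTime n) (funext fun m => propext (zEvent_iff ω m))

theorem isolatedSet_zTime_subsingleton {n : ℕ} (hn : 2 ≤ n) (σ : Equiv.Perm (DEdge n)) :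
    (isolatedSet σ (zTime σ)).Subsingleton := by
  have hmem := Nat.sInf_mem (s := {m | (isolatedSet σ m).Subsingleton} ∪ {n * (n - 1)})
    ⟨n * (n - 1), Or.inr rfl⟩
  rcases hmem with h | h
  · exact h
  · rw [zTime, hitTime, Set.mem_singleton_iff.1 h, isolatedSet_total hn]
    exact Set.subsingleton_empty

theorem le_zTime {n m : ℕ} {σ : Equiv.Perm (DEdge n)} (hm : m ≤ n * (n - 1))
    (h : ¬ (isolatedSet σ m).Subsingleton) : m ≤ zTime σ := by
  refine le_csInf ⟨n * (n - 1), Or.inr rfl⟩ ?_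
  rintro b (hb | hb)
  · by_contra! hlt
    exact h (Set.Subsingleton.anti hb (isolatedSet_anti σ hlt.le))
  · exact hm.trans (Set.mem_singleton_iff.1 hb).ge

/-- The event that all vertices except possibly one can be assigned distinct colours of their
in-edges at the hitting time. -/
def Assignable {n : ℕ} (ω : SampleSpace n) : Prop :=
  ∃ (T : Set (Colour n)) (u : Fin n) (f : Fin n → Colour n),
    T.ncard = n - 1 ∧
    Set.BijOn f {v : Fin n | v ≠ u} T ∧
    ∀ v : Fin n, v ≠ u → ∃ e : DEdge n,
      inProcess ω (hitTime n (ZEvent ω)) e ∧ e.val.2 = v ∧ ω.2 e = f v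

theorem assignable_of_injOn {n : ℕ} (hn : 2 ≤ n) (ω : SampleSpace n) (f : Fin n → Colour n)
    (hinj : Set.InjOn f (isolatedSet ω.1 (zTime ω.1))ᶜ)
    (hf : ∀ v ∉ isolatedSet ω.1 (zTime ω.1), ∃ e ∈ inEdges v,
      ω.1 e ∉ latePositions n (zTime ω.1) ∧ ω.2 e = f v) : Assignable ω := by
  obtain ⟨u, hu⟩ : ∃ u : Fin n, ∀ v ≠ u, v ∉ isolatedSet ω.1 (zTime ω.1) := by
    rcases (isolatedSet_zTime_subsingleton hn ω.1).eq_empty_or_singleton with h | ⟨u, h⟩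
    · exact ⟨⟨0, by omega⟩, by simp [h]⟩
    · exact ⟨u, by simp [h]⟩
  have hinj' : Set.InjOn f {v : Fin n | v ≠ u} := hinj.mono fun v hv => hu v hv
  refine ⟨f '' {v | v ≠ u}, u, f, ?_, hinj'.bijOn_image, ?_⟩
  · rw [hinj'.ncard_image]
    have : {v : Fin n | v ≠ u} = ({u} : Set (Fin n))ᶜ := rfl
    rw [this, Set.ncard_compl, Set.ncard_singleton, Nat.card_eq_fintype_card, Fintype.card_fin]
  · intro v hv
    obtain ⟨e, he, hlate, hcol⟩ := hf v (hu v hv)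
    exact ⟨e, by rwa [hitTime_zEvent, inProcess_iff], mem_inEdges.1 he, hcol⟩

theorem hallBound_nonneg (n K l d : ℕ) : 0 ≤ hallBound n K l d := by
  unfold hallBound
  positivity

theorem prob_not_assignable_le_of_good {n m l d : ℕ} (hn : 2 ≤ n) (hm : m ≤ n * (n - 1))
    (hK : n ≤ numColours n) (σ : Equiv.Perm (DEdge n))
    (hiso : ¬ (isolatedSet σ m).Subsingleton) (hlow : #{v : Fin n | inDeg σ m v < d} ≤ l) :
    prob (fun c : DEdge n → Colour n => ¬ Assignable (σ, c)) ≤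
      hallBound n (numColours n) l d := by
  classical
  have hle := le_zTime hm hiso
  have : Nonempty (Colour n) := ⟨⟨0, by omega⟩⟩
  have : Nonempty (DEdge n) := ⟨⟨(⟨0, by omega⟩, ⟨1, by omega⟩), by simp⟩⟩
  set I := isolatedSet σ (zTime σ) with hI
  set L : Finset (Fin n) := {v | inDeg σ m v < d ∧ v ∉ I} with hL
  set H : Finset (Fin n) := {v | d ≤ inDeg σ m v} with hH
  have hexe : ∀ v ∈ L, ∃ e, e ∈ inEdges v ∧ σ e ∉ latePositions n (zTime σ) := by
    intro v hv
    have : v ∉ I := (Finset.mem_filter.1 hv).2.2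
    simpa [hI, isolatedSet] using this
  have hexD : ∀ v ∈ H, ∃ D ⊆ ({e ∈ inEdges v | σ e ∉ latePositions n m} : Finset (DEdge n)),
      #D = d := fun v hv => Finset.exists_subset_card_eq (Finset.mem_filter.1 hv).2
  choose! e he using hexe
  choose! D hDsub hD using hexD
  have hbound := prob_not_exists_injOn_colouring_le (W := Colour n) (l := l) (d := d)
    (L := L) (H := H) (fun e : DEdge n => e.val.2) (e := e) (D := D)
    (by simpa using hK)
    (Finset.disjoint_left.2 fun v hv hv' =>
      absurd (Finset.mem_filter.1 hv).2.1 (not_lt.2 (Finset.mem_filter.1 hv').2))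
    ((Finset.card_le_card fun v hv => by
      simp only [hL, Finset.mem_filter, Finset.mem_univ, true_and] at hv ⊢
      exact hv.1).trans hlow)
    (fun v hv => mem_inEdges.1 (he v hv).1) hD
    (fun v hv x hx => mem_inEdges.1 (Finset.mem_filter.1 (hDsub v hv hx)).1)
  simp only [Fintype.card_fin] at hbound
  refine (prob_mono fun c hc => ?_).trans hbound
  rintro ⟨f, hinj, hf⟩
  have hcover : ∀ v ∉ I, v ∈ L ∪ H := by
    intro v hv
    rcases lt_or_ge (inDeg σ m v) d with h | h
    · exact Finset.mem_union_left _ (Finset.mem_filter.2 ⟨Finset.mem_univ _, h, hv⟩)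
    · exact Finset.mem_union_right _ (Finset.mem_filter.2 ⟨Finset.mem_univ _, h⟩)
  refine hc (assignable_of_injOn hn (σ, c) f (hinj.mono fun v hv => hcover v hv) fun v hv => ?_)
  rcases hf v (hcover v hv) with ⟨hvL, hfv⟩ | ⟨hvH, x, hx, hfx⟩
  · exact ⟨e v, (he v hvL).1, (he v hvL).2, hfv.symm⟩
  · obtain ⟨hx1, hx2⟩ := Finset.mem_filter.1 (hDsub v hvH hx)
    exact ⟨x, hx1, fun h => hx2 (mem_latePositions_of_le hle h), hfx⟩

theorem prob_not_assignable_le {n m l d : ℕ} (hn : 2 ≤ n) (hm : m + 2 * (n - 1) ≤ n * (n - 1))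
    (hK : n ≤ numColours n) (hμ : 1 < n * isolatedProb n m) :
    prob (fun ω : SampleSpace n => ¬ Assignable ω) ≤
      (n * isolatedProb n m) / (n * isolatedProb n m - 1) ^ 2 +
        (n * (4 ^ d * Real.exp (-(3 / 4 * m / n))) / (l + 1) +
          hallBound n (numColours n) l d) := by
  have : Nonempty (Colour n) := ⟨⟨0, by omega⟩⟩
  let bad₁ : Equiv.Perm (DEdge n) → Prop := fun σ => (isolatedSet σ m).Subsingleton
  let bad₂ : Equiv.Perm (DEdge n) → Prop := fun σ => l < #{v : Fin n | inDeg σ m v < d}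
  let bad₃ : Equiv.Perm (DEdge n) → (DEdge n → Colour n) → Prop :=
    fun σ c => (¬ bad₁ σ ∧ ¬ bad₂ σ) ∧ ¬ Assignable (σ, c)
  have h₁ : prob (fun ω : SampleSpace n => bad₁ ω.1) ≤
      (n * isolatedProb n m) / (n * isolatedProb n m - 1) ^ 2 := by
    rw [prob_prod_fst]
    exact prob_subsingleton_late_le hm hμ
  have h₂ : prob (fun ω : SampleSpace n => bad₂ ω.1) ≤
      n * (4 ^ d * Real.exp (-(3 / 4 * m / n))) / (l + 1) := by
    rw [prob_prod_fst]
    exact prob_card_inDeg_lt_le hn (by omega) d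
  have h₃ : prob (fun ω : SampleSpace n => bad₃ ω.1 ω.2) ≤ hallBound n (numColours n) l d := by
    refine prob_prod_le bad₃ fun σ => ?_
    by_cases hσ : ¬ bad₁ σ ∧ ¬ bad₂ σ
    · exact (prob_mono fun c hc => hc.2).trans
        (prob_not_assignable_le_of_good hn (by omega) hK σ hσ.1 (not_lt.1 hσ.2))
    · have : prob (bad₃ σ) = 0 := by
        have hempty : ∀ c, ¬ bad₃ σ c := fun c hc => hσ hc.1
        simp [prob, hempty]
      rw [this]
      exact hallBound_nonneg _ _ _ _
  refine (prob_mono fun ω hω => ?_).trans ((prob_or_le (fun ω : SampleSpace n => bad₁ ω.1)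
    fun ω => bad₂ ω.1 ∨ bad₃ ω.1 ω.2).trans
      (add_le_add h₁ ((prob_or_le _ _).trans (add_le_add h₂ h₃))))
  by_cases hb₁ : bad₁ ω.1
  · exact Or.inl hb₁
  by_cases hb₂ : bad₂ ω.1
  · exact Or.inr (Or.inl hb₂)
  · exact Or.inr (Or.inr ⟨⟨hb₁, hb₂⟩, hω⟩)

end Combination

section Asymptotics

open Real

/-- The number of edges at which the process is first inspected. -/
noncomputable def startTime (n : ℕ) : ℕ := ⌊9 / 10 * n * log n⌋₊

/-- The bound on the number of vertices of low in-degree. -/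
noncomputable def lowBound (n : ℕ) : ℕ := ⌊exp (9 / 20 * log n)⌋₊

/-- Vertices whose in-degree is smaller than this are regarded as being of low in-degree. -/
noncomputable def lowDegree (n : ℕ) : ℕ := ⌊log n / 50⌋₊

theorem le_isolatedProb {n m : ℕ} (hn : 2 ≤ n)
    (hm : (m : ℝ) < n * (n - 1) - n) :
    exp (-((n - 1) * m / (n * (n - 1) - n - m))) ≤ isolatedProb n m := by
  have hn2 : (2 : ℝ) ≤ n := by exact_mod_cast hn
  have hcast : ((n - 1 : ℕ) : ℝ) = (n : ℝ) - 1 := by rw [Nat.cast_sub (by omega)]; simp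
  have hN : ((n * (n - 1) : ℕ) : ℝ) = n * (n - 1) := by rw [Nat.cast_mul, hcast]
  have hm0 : (0 : ℝ) ≤ m := Nat.cast_nonneg m
  set M : ℝ := n * (n - 1) - n with hM
  have hfac : ∀ i ∈ range (n - 1), exp (-(m / (M - m))) ≤
      (((n * (n - 1) : ℕ) : ℝ) - m - i) / (((n * (n - 1) : ℕ) : ℝ) - i) := by
    intro i hi
    have hi' : (i : ℝ) + 1 ≤ (n : ℝ) - 1 := by
      rw [← hcast]
      exact_mod_cast Finset.mem_range.1 hi
    rw [hN]
    have hMi : M ≤ (n : ℝ) * (n - 1) - i := by linarith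
    have hpos : 0 < M - m := by linarith
    have hle : 1 + m / ((n : ℝ) * (n - 1) - m - i) ≤ exp (m / (M - m)) := by
      refine le_trans ?_ (add_one_le_exp _)
      rw [add_comm]
      exact add_le_add (div_le_div_of_nonneg_left hm0 hpos (by linarith)) le_rfl
    have hpos' : 0 < (n : ℝ) * (n - 1) - m - i := by linarith
    rw [exp_neg, inv_le_comm₀ (exp_pos _) (div_pos hpos' (by linarith)), inv_div]
    refine le_trans (le_of_eq ?_) hle
    field_simp
    ring
  calc exp (-((n - 1) * m / (M - m))) = ∏ _i ∈ range (n - 1), exp (-(m / (M - m))) := by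
        rw [Finset.prod_const, Finset.card_range, ← exp_nat_mul, hcast]
        congr 1
        ring
    _ ≤ isolatedProb n m := Finset.prod_le_prod (fun i _ => (exp_pos _).le) hfac

theorem exp_le_mul_isolatedProb {n : ℕ} (hn : 200 ≤ n) (hlog : log n ≤ n / 100) :
    exp (1 / 20 * log n) ≤ n * isolatedProb n (startTime n) := by
  have hn' : (200 : ℝ) ≤ n := by exact_mod_cast hn
  have hx : 0 ≤ log n := log_nonneg (by linarith)
  have hm : (startTime n : ℝ) ≤ 9 / 10 * n * log n := Nat.floor_le (by positivity)
  have hm0 : (0 : ℝ) ≤ startTime n := Nat.cast_nonneg _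
  have hm1 : (startTime n : ℝ) ≤ 9 / 1000 * n * n := by nlinarith
  have hlt : (startTime n : ℝ) < n * (n - 1) - n := by nlinarith
  have hkey : ((n : ℝ) - 1) * startTime n / (n * (n - 1) - n - startTime n) ≤ 19 / 20 * log n := by
    rw [div_le_iff₀ (by linarith)]
    have h1 : ((n : ℝ) - 1) * startTime n ≤ (n - 1) * (9 / 10 * n * log n) :=
      mul_le_mul_of_nonneg_left hm (by linarith)
    have h2 : 19 / 20 * log n * (n * (n - 1) - n - 9 / 10 * n * log n) ≤
        19 / 20 * log n * (n * (n - 1) - n - startTime n) :=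
      mul_le_mul_of_nonneg_left (by linarith) (by positivity)
    have h3 : 0 ≤ (n * log n) * (19 / 20 * (n - 2 - 9 / 10 * log n) - 9 / 10 * (n - 1)) :=
      mul_nonneg (by positivity) (by linarith)
    nlinarith
  calc exp (1 / 20 * log n) = n * exp (-(19 / 20 * log n)) := by
        nth_rewrite 2 [← exp_log (show (0 : ℝ) < n by linarith)]
        rw [← exp_add]
        congr 1
        ring
    _ ≤ n * exp (-((n - 1) * startTime n / (n * (n - 1) - n - startTime n))) := by gcongr
    _ ≤ _ := by
        gcongr
        exact le_isolatedProb (by omega) hlt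

theorem startTime_add_le {n : ℕ} (hn : 200 ≤ n) (hlog : log n ≤ n / 100) :
    startTime n + 2 * (n - 1) ≤ n * (n - 1) := by
  have hn' : (200 : ℝ) ≤ n := by exact_mod_cast hn
  have hx : 0 ≤ log n := log_nonneg (by linarith)
  have hm : (startTime n : ℝ) ≤ 9 / 10 * n * log n := Nat.floor_le (by positivity)
  have hcast : ((n - 1 : ℕ) : ℝ) = (n : ℝ) - 1 := by rw [Nat.cast_sub (by omega)]; simp
  have : (startTime n : ℝ) + 2 * ((n - 1 : ℕ) : ℝ) ≤ n * ((n - 1 : ℕ) : ℝ) := by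
    rw [hcast]
    nlinarith
  exact_mod_cast this

theorem lowDegree_term_le {n : ℕ} (hn : 200 ≤ n) :
    n * (4 ^ lowDegree n * exp (-(3 / 4 * startTime n / n))) / (lowBound n + 1) ≤
      exp 1 * exp (-(1 / 20 * log n)) := by
  have hn' : (200 : ℝ) ≤ n := by exact_mod_cast hn
  have hn0 : (0 : ℝ) < n := by linarith
  have hx : 0 ≤ log n := log_nonneg (by linarith)
  have hm : 9 / 10 * n * log n - 1 ≤ (startTime n : ℝ) := (Nat.sub_one_lt_floor _).le
  have hd : (lowDegree n : ℝ) ≤ log n / 50 := Nat.floor_le (by positivity)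
  have hl : exp (9 / 20 * log n) ≤ (lowBound n : ℝ) + 1 := (Nat.lt_floor_add_one _).le
  have h4 : (4 : ℝ) ^ lowDegree n ≤ exp (log n / 25) := by
    calc (4 : ℝ) ^ lowDegree n ≤ (exp 2) ^ lowDegree n := by
          have h1 := exp_one_gt_d9
          have h2 : exp 2 = exp 1 * exp 1 := by rw [← exp_add]; norm_num
          gcongr
          nlinarith
      _ = exp (lowDegree n * 2) := (exp_nat_mul _ _).symm
      _ ≤ _ := by
          gcongr
          linarith
  have he : exp (-(3 / 4 * startTime n / n)) ≤ exp (1 - 27 / 40 * log n) := by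
    gcongr
    have : 27 / 40 * log n - 1 ≤ 3 / 4 * startTime n / n := by
      rw [le_div_iff₀ hn0]
      nlinarith
    linarith
  rw [div_le_iff₀ (by positivity)]
  calc n * (4 ^ lowDegree n * exp (-(3 / 4 * startTime n / n)))
      ≤ exp (log n) * (exp (log n / 25) * exp (1 - 27 / 40 * log n)) := by
        rw [exp_log hn0]
        gcongr
    _ ≤ exp 1 * exp (-(1 / 20 * log n)) * exp (9 / 20 * log n) := by
        simp only [← exp_add]
        exact exp_le_exp.2 (by linarith)
    _ ≤ _ := by gcongr

theorem hallBound_le {n : ℕ} (hn : 200 ≤ n) (hlog : 100 ≤ log n)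
    (hloglog : 1600 * exp 201 ≤ log (log n)) (heps : eps n ≤ 1 / 50)
    (hexp : log n ≤ exp (1 / 2 * log n)) (hbig : exp 201 * exp (9 / 20 * log n) ≤ n)
    (hsmall : 2 * exp 200 * exp (-(2 * log n)) ≤ 1) :
    n ≤ numColours n ∧ hallBound n (numColours n) (lowBound n) (lowDegree n) ≤
      exp (-(1 / 10 * log n)) + (2 * exp 200 * exp (-log n) + n * exp (-n)) := by
  have hn' : (200 : ℝ) ≤ n := by exact_mod_cast hn
  have hn0 : (0 : ℝ) < n := by linarith
  have hx0 : 0 < log n := by linarith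
  have hnx : exp (log n) = n := exp_log hn0
  set x := log n with hx
  set K := numColours n with hK
  set l := lowBound n with hl
  set d := lowDegree n with hd
  have h201 : (1 : ℝ) ≤ exp 201 := one_le_exp (by norm_num)
  have hepsx : eps n * x = log x := by
    rw [eps, ← hx]
    field_simp
  have heps0 : 0 ≤ eps n := by
    rw [eps, ← hx]
    exact div_nonneg (by linarith) hx0.le
  have hKle : (K : ℝ) ≤ (1 + 50 * eps n) * n := Nat.floor_le (by positivity)
  have hKge : (1 + 50 * eps n) * n - 1 ≤ (K : ℝ) := (Nat.sub_one_lt_floor _).le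
  have hK2 : (K : ℝ) ≤ 2 * n := hKle.trans (by nlinarith)
  have hnK : n ≤ K := Nat.le_floor (by nlinarith)
  have hnK' : (n : ℝ) ≤ K := by exact_mod_cast hnK
  have hK0 : (0 : ℝ) < K := by linarith
  have hlle : (l : ℝ) ≤ exp (9 / 20 * x) := Nat.floor_le (exp_pos _).le
  have hl0 : (0 : ℝ) ≤ l := Nat.cast_nonneg _
  have hdge : x / 50 - 1 ≤ (d : ℝ) := (Nat.sub_one_lt_floor _).le
  refine ⟨hnK, ?_⟩
  have hfirst : (l : ℝ) ^ 2 / K ≤ exp (-(1 / 10 * x)) := by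
    calc (l : ℝ) ^ 2 / K ≤ (exp (9 / 20 * x)) ^ 2 / exp x := by
          rw [hnx]
          gcongr
      _ = _ := by
          rw [← exp_nat_mul, ← exp_sub]
          congr 1
          push_cast
          ring
  -- The colours available to a set of vertices are a proportion at most `1 - ε` of all colours.
  have hratio : ((n : ℝ) + l) / K ≤ exp (-eps n) := by
    refine le_trans ?_ (one_sub_le_exp_neg _)
    rw [div_le_iff₀ hK0]
    have hlog1 : 1 ≤ log x := by linarith
    have h1 : (l : ℝ) + 1 ≤ 48 * (eps n * n) := by
      have h2 : (l : ℝ) + 1 ≤ 2 * exp (9 / 20 * x) := by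
        linarith [one_le_exp (show 0 ≤ 9 / 20 * x by positivity)]
      have h3 : exp (9 / 20 * x) * x ≤ n := by
        calc exp (9 / 20 * x) * x ≤ exp (9 / 20 * x) * exp (1 / 2 * x) := by gcongr
          _ = exp (19 / 20 * x) := by
              rw [← exp_add]
              congr 1
              ring
          _ ≤ exp x := by
              gcongr
              linarith
          _ = n := hnx
      have h4 : exp (9 / 20 * x) * x ≤ eps n * n * x := by
        nlinarith
      have h5 : exp (9 / 20 * x) ≤ eps n * n := le_of_mul_le_mul_right h4 hx0
      have h6 : 0 ≤ eps n * n := by positivity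
      linarith
    have h7 : (1 - eps n) * ((1 + 50 * eps n) * n - 1) ≤ (1 - eps n) * K :=
      mul_le_mul_of_nonneg_left hKge (by linarith)
    have h8 : 50 * eps n * (eps n * n) ≤ 1 * (eps n * n) := by
      gcongr
      linarith
    nlinarith
  have hepsd : 4 ≤ eps n * d * (exp (-201)) := by
    have h1 : log x / 100 ≤ eps n * d := by
      have h2 : eps n * (x / 100) ≤ eps n * d := by
        gcongr
        linarith
      calc log x / 100 = eps n * (x / 100) := by rw [← hepsx]; ring
        _ ≤ _ := h2
    have h3 : 4 * exp 201 ≤ eps n * d := by linarith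
    rw [exp_neg, ← div_eq_mul_inv, le_div_iff₀ (exp_pos _)]
    exact h3
  have hterm : ∀ b ∈ Icc 1 n, (n.choose b : ℝ) * (K.choose b) *
      (((b + l : ℕ) : ℝ) / K) ^ (d * b) ≤ 2 * exp 200 * exp (-(2 * x)) + exp (-n) := by
    intro b hb
    rw [Finset.mem_Icc] at hb
    have hb1 : (1 : ℝ) ≤ b := by exact_mod_cast hb.1
    have hbn : (b : ℝ) ≤ n := by exact_mod_cast hb.2
    rcases le_or_gt (b : ℝ) (exp (-201) * n) with hbs | hbl
    · have hq : ((b + l : ℕ) : ℝ) / K ≤ exp (-200) := by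
        have h1 : (l : ℝ) ≤ exp (-201) * n := by
          rw [exp_neg, ← div_eq_inv_mul, le_div_iff₀ (exp_pos _), mul_comm]
          exact le_trans (by gcongr) hbig
        have h2 : 2 * exp (-201) ≤ exp (-200) := by
          have h3 : exp (-200) = exp 1 * exp (-201) := by rw [← exp_add]; norm_num
          rw [h3]
          gcongr
          linarith [exp_one_gt_d9]
        rw [div_le_iff₀ hK0]
        push_cast
        calc (b : ℝ) + l ≤ 2 * exp (-201) * n := by linarith
          _ ≤ exp (-200) * K := by gcongr
      have hqd : (((b + l : ℕ) : ℝ) / K) ^ d ≤ exp (200 - 4 * x) := by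
        calc (((b + l : ℕ) : ℝ) / K) ^ d ≤ (exp (-200)) ^ d := by gcongr
          _ = exp (d * (-200)) := (exp_nat_mul _ _).symm
          _ ≤ _ := by
              gcongr
              linarith
      have hc1 : (n.choose b : ℝ) ≤ (n : ℝ) ^ b := by exact_mod_cast Nat.choose_le_pow n b
      have hc2 : (K.choose b : ℝ) ≤ (2 * n : ℝ) ^ b := by
        calc (K.choose b : ℝ) ≤ (K : ℝ) ^ b := by exact_mod_cast Nat.choose_le_pow K b
          _ ≤ _ := by gcongr
      have hr : n * (2 * n) * exp (200 - 4 * x) = 2 * exp 200 * exp (-(2 * x)) := by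
        rw [← hnx]
        calc exp x * (2 * exp x) * exp (200 - 4 * x)
            = 2 * (exp x * exp x * exp (200 - 4 * x)) := by ring
          _ = 2 * (exp 200 * exp (-(2 * x))) := by
              rw [← exp_add, ← exp_add, ← exp_add]
              congr 2
              ring
          _ = _ := by ring
      calc (n.choose b : ℝ) * (K.choose b) * (((b + l : ℕ) : ℝ) / K) ^ (d * b)
          ≤ (n : ℝ) ^ b * (2 * n) ^ b * (exp (200 - 4 * x)) ^ b := by
            rw [pow_mul]
            gcongr
        _ = (2 * exp 200 * exp (-(2 * x))) ^ b := by rw [← mul_pow, ← mul_pow, hr]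
        _ ≤ 2 * exp 200 * exp (-(2 * x)) :=
            pow_le_of_le_one (by positivity) hsmall (by omega)
        _ ≤ _ := le_add_of_nonneg_right (exp_pos _).le
    · have hq : ((b + l : ℕ) : ℝ) / K ≤ exp (-eps n) := by
        refine le_trans ?_ hratio
        push_cast
        gcongr
      have hpow : (((b + l : ℕ) : ℝ) / K) ^ (d * b) ≤ exp (-(4 * n)) := by
        calc (((b + l : ℕ) : ℝ) / K) ^ (d * b) ≤ (exp (-eps n)) ^ (d * b) := by gcongr
          _ = exp (((d * b : ℕ) : ℝ) * -eps n) := (exp_nat_mul _ _).symm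
          _ ≤ _ := by
              gcongr
              push_cast
              have h1 : eps n * d * (exp (-201) * n) ≤ eps n * d * b := by gcongr
              nlinarith
      have htwo : ∀ a b : ℕ, (a.choose b : ℝ) ≤ exp a := by
        intro a b
        calc (a.choose b : ℝ) ≤ (2 : ℝ) ^ a := by exact_mod_cast Nat.choose_le_two_pow a b
          _ ≤ (exp 1) ^ a := by
              gcongr
              linarith [exp_one_gt_d9]
          _ = exp a := by rw [← exp_nat_mul, mul_one]
      calc (n.choose b : ℝ) * (K.choose b) * (((b + l : ℕ) : ℝ) / K) ^ (d * b)
          ≤ exp n * exp K * exp (-(4 * n)) := by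
            gcongr
            · exact htwo n b
            · exact htwo K b
        _ ≤ exp (-n) := by
            rw [← exp_add, ← exp_add]
            gcongr
            linarith
        _ ≤ _ := le_add_of_nonneg_left (by positivity)
  unfold hallBound
  refine add_le_add hfirst ((Finset.sum_le_sum hterm).trans (le_of_eq ?_))
  rw [Finset.sum_const, Nat.card_Icc, nsmul_eq_mul, Nat.add_sub_cancel, mul_add]
  congr 1
  have : (n : ℝ) * exp (-(2 * x)) = exp (-x) := by
    nth_rewrite 1 [← hnx]
    rw [← exp_add]
    congr 1
    ring
  rw [← this]
  ring

theorem eventually_le_numColours : ∀ᶠ n : ℕ in atTop, n ≤ numColours n := by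
  have hlogn : Tendsto (fun n : ℕ => log n) atTop atTop :=
    tendsto_log_atTop.comp tendsto_natCast_atTop_atTop
  filter_upwards [hlogn.eventually_ge_atTop 1] with n hn
  have heps : 0 ≤ eps n := div_nonneg (log_nonneg hn) (by linarith)
  have hn0 : (0 : ℝ) ≤ n := Nat.cast_nonneg n
  exact Nat.le_floor (by nlinarith)

theorem tendsto_prob_not_assignable :
    Tendsto (fun n : ℕ => prob fun ω : SampleSpace n => ¬ Assignable ω) atTop (nhds 0) := by
  have hcast : Tendsto (fun n : ℕ => (n : ℝ)) atTop atTop := tendsto_natCast_atTop_atTop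
  have hlogn : Tendsto (fun n : ℕ => log n) atTop atTop := tendsto_log_atTop.comp hcast
  have hexpneg : ∀ a : ℝ, 0 < a → Tendsto (fun n : ℕ => exp (-(a * log n))) atTop (nhds 0) :=
    fun a ha => tendsto_exp_neg_atTop_nhds_zero.comp (hlogn.const_mul_atTop ha)
  have hμ : Tendsto (fun n : ℕ => n * isolatedProb n (startTime n)) atTop atTop := by
    refine tendsto_atTop_mono' atTop ?_
      (tendsto_exp_atTop.comp (hlogn.const_mul_atTop (show (0 : ℝ) < 1 / 20 by norm_num)))
    filter_upwards [eventually_ge_atTop 200,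
      (isLittleO_log_id_atTop.comp_tendsto hcast).bound (show (0 : ℝ) < 1 / 100 by norm_num)]
      with n hn hlog
    simp only [Function.comp_apply, id_eq, norm_eq_abs, Nat.abs_cast] at hlog
    exact exp_le_mul_isolatedProb hn (by linarith [le_abs_self (log n)])
  have hfrac : Tendsto (fun t : ℝ => t / (t - 1) ^ 2) atTop (nhds 0) := by
    have h1 : Tendsto (fun t : ℝ => 4 * t⁻¹) atTop (nhds 0) := by
      simpa using tendsto_inv_atTop_zero.const_mul (4 : ℝ)
    refine squeeze_zero' ?_ ?_ h1
    · filter_upwards [eventually_ge_atTop 0] with t ht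
      positivity
    · filter_upwards [eventually_ge_atTop 2] with t ht
      rw [← div_eq_mul_inv, div_le_div_iff₀ (by nlinarith) (by linarith)]
      nlinarith
  have hnexp : Tendsto (fun n : ℕ => (n : ℝ) * exp (-n)) atTop (nhds 0) := by
    simpa [Function.comp_def] using (tendsto_pow_mul_exp_neg_atTop_nhds_zero 1).comp hcast
  have hbound : Tendsto (fun n : ℕ =>
      (n * isolatedProb n (startTime n)) / (n * isolatedProb n (startTime n) - 1) ^ 2 +
        (exp 1 * exp (-(1 / 20 * log n)) + (exp (-(1 / 10 * log n)) +
          (2 * exp 200 * exp (-(1 * log n)) + n * exp (-n))))) atTop (nhds 0) := by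
    have := (hfrac.comp hμ).add (((hexpneg (1 / 20) (by norm_num)).const_mul (exp 1)).add
      ((hexpneg (1 / 10) (by norm_num)).add
        (((hexpneg 1 one_pos).const_mul (2 * exp 200)).add hnexp)))
    simpa only [mul_zero, add_zero, Function.comp_apply] using this
  refine squeeze_zero' (Eventually.of_forall fun n => prob_nonneg _) ?_ hbound
  have heps : Tendsto eps atTop (nhds 0) := by
    have := isLittleO_log_id_atTop.tendsto_div_nhds_zero.comp hlogn
    exact this
  have hhalf : ∀ᶠ n : ℕ in atTop, log n ≤ exp (1 / 2 * log n) := by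
    have := (tendsto_pow_mul_exp_neg_atTop_nhds_zero 1).comp
      (hlogn.const_mul_atTop (show (0 : ℝ) < 1 / 2 by norm_num))
    filter_upwards [this.eventually (eventually_le_nhds (show (0 : ℝ) < 1 / 2 by norm_num))]
      with n hn
    simp only [Function.comp_apply, pow_one, exp_neg] at hn
    rw [← div_eq_mul_inv, div_le_iff₀ (exp_pos _)] at hn
    linarith
  filter_upwards [eventually_ge_atTop 200,
    (isLittleO_log_id_atTop.comp_tendsto hcast).bound (show (0 : ℝ) < 1 / 100 by norm_num),
    hlogn.eventually_ge_atTop 100,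
    (tendsto_log_atTop.comp hlogn).eventually_ge_atTop (1600 * exp 201),
    heps.eventually (eventually_le_nhds (show (0 : ℝ) < 1 / 50 by norm_num)), hhalf,
    (hexpneg (11 / 20) (by norm_num)).eventually
      (eventually_le_nhds (show (0 : ℝ) < (exp 201)⁻¹ by positivity)),
    (hexpneg 2 (by norm_num)).eventually
      (eventually_le_nhds (show (0 : ℝ) < (2 * exp 200)⁻¹ by positivity)),
    hμ.eventually_gt_atTop 1] with n hn hlog hlog100 hloglog hepsn hexp hbig hsmall hμ1
  simp only [Function.comp_apply, id_eq, norm_eq_abs, Nat.abs_cast] at hlog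
  have hlog' : log n ≤ n / 100 := by linarith [le_abs_self (log n)]
  have hn0 : (0 : ℝ) < n := by
    have : 0 < n := by omega
    exact_mod_cast this
  have hbig' : exp 201 * exp (9 / 20 * log n) ≤ n := by
    rw [le_inv_comm₀ (exp_pos _) (exp_pos _), ← exp_neg, neg_neg] at hbig
    calc exp 201 * exp (9 / 20 * log n) ≤ exp (11 / 20 * log n) * exp (9 / 20 * log n) := by
          gcongr
      _ = exp (log n) := by
          rw [← exp_add]
          congr 1
          ring
      _ = n := exp_log hn0
  have hsmall' : 2 * exp 200 * exp (-(2 * log n)) ≤ 1 := by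
    calc 2 * exp 200 * exp (-(2 * log n)) ≤ 2 * exp 200 * (2 * exp 200)⁻¹ := by gcongr
      _ = 1 := mul_inv_cancel₀ (by positivity)
  obtain ⟨hnK, hhall⟩ := hallBound_le hn hlog100 hloglog hepsn hexp hbig' hsmall'
  refine (prob_not_assignable_le (l := lowBound n) (d := lowDegree n) (by omega)
    (startTime_add_le hn hlog') hnK hμ1).trans ?_
  rw [one_mul]
  gcongr
  exact lowDegree_term_le hn

end Asymptotics

end RandomDigraph

/-- A.a.s. in `D(n, m_Z)` there exist a set `T ⊆ W` of `n - 1`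
colours, a vertex `u`, and a bijection `f : V \ {u} → T` such that every vertex
`v ≠ u` has an in-edge (an edge with head `v`) of colour `f v`. -/
theorem aas_colour_assignment :
    Tendsto
      (fun n : ℕ => prob (fun ω : SampleSpace n =>
        ∃ (T : Set (Colour n)) (u : Fin n) (f : Fin n → Colour n),
          T.ncard = n - 1 ∧
          Set.BijOn f {v : Fin n | v ≠ u} T ∧
          ∀ v : Fin n, v ≠ u → ∃ e : DEdge n,
            inProcess ω (hitTime n (ZEvent ω)) e ∧ e.val.2 = v ∧ ω.2 e = f v))
      atTop (nhds 1) := by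
  refine Tendsto.congr' (f₁ := fun n : ℕ => 1 - prob fun ω : SampleSpace n => ¬ Assignable ω) ?_ ?_
  · filter_upwards [eventually_le_numColours, eventually_gt_atTop 0] with n hn hn0
    have : Nonempty (Colour n) := ⟨⟨0, by omega⟩⟩
    change 1 - _ = prob fun ω : SampleSpace n => Assignable ω
    linarith [prob_add_prob_not fun ω : SampleSpace n => Assignable ω]
  · simpa using tendsto_prob_not_assignable.const_sub 1
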